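/- arXiv:2403.18075 — 2 statements merged into one kernel-verified Lean document; each statement's English description precedes it below -/
import Mathlib

section
/- Let u = y_0^{s_1−1} y_1 ⋯ y_0^{s_d−1} y_1 be an admissible word over {y_0, y_1} (containing no letter y_{−1}) and let v be an admissible word over {y_0, y_1, y_{−1}}, such that depth(u) + depth(v) is even. Then for every odd prime p, T_p(u ⧢ v) = (−1)^{s_1+⋯+s_d} · T_p(y_0^{s_d−1} y_1 ⋯ y_0^{s_1−1} y_1 · v) in ℤ/pℤ, where the word in the last expression is the concatenation of the reversed-block word of u with v. -/
open scoped Classical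

/-- Finite alternating multiple T-sum `T_p(s;σ)`, with entries `(s_j, σ_j)`:
the sum over `p > n₁ > ⋯ > n_d > 0` with `n_j ≡ d−j+1 (mod 2)` (1-based) of
`∏ σ_j^{(n_j−d+j−1)/2} n_j^{−s_j}` in `ℤ/pℤ` (written 0-based below). -/
noncomputable def TaltP (p : ℕ) (l : List (ℕ × ℤ)) : ZMod p :=
  ∑ n : Fin l.length → Fin p,
    if (∀ j, 0 < (n j : ℕ)) ∧ (∀ i j : Fin l.length, i < j → (n j : ℕ) < (n i : ℕ)) ∧
       (∀ j : Fin l.length, (n j : ℕ) % 2 = (l.length - (j : ℕ)) % 2)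
    then ∏ j, ((l.get j).2 : ZMod p) ^ (((n j : ℕ) + (j : ℕ) - l.length) / 2) *
              (((n j : ℕ) : ZMod p) ^ (l.get j).1)⁻¹
    else 0

/-- The alphabet `{y₀, y₁, y₋₁}`. -/
inductive Letter : Type
  | y0 : Letter
  | y1 : Letter
  | ym1 : Letter
  deriving DecidableEq

/-- The shuffle product of two words, as the multiset of interleavings. -/
def shuffle {α : Type} : List α → List α → Multiset (List α)
  | [], v => {v}
  | a :: u, [] => {a :: u}
  | a :: u, b :: v =>
      (shuffle u (b :: v)).map (List.cons a) + (shuffle (a :: u) v).map (List.cons b)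
termination_by u v => u.length + v.length

/-- A word is admissible if it is empty or does not end in `y₀`. -/
def Admissible (w : List Letter) : Prop := w.getLast? ≠ some Letter.y0

/-- The depth of a word: the number of letters different from `y₀`. -/
def depth (w : List Letter) : ℕ := (w.filter (fun a => a ≠ Letter.y0)).length

/-- Parse an admissible word into its blocks: `y₀^(s-1) y_η ↦ (s, η)`;
returns `none` on non-admissible words. -/
def parseAux : ℕ → List Letter → Option (List (ℕ × ℤ))
  | k, [] => if k = 0 then some [] else none
  | k, Letter.y0 :: w => parseAux (k + 1) w
  | k, Letter.y1 :: w => (parseAux 0 w).map (fun l => (k + 1, (1 : ℤ)) :: l)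
  | k, Letter.ym1 :: w => (parseAux 0 w).map (fun l => (k + 1, (-1 : ℤ)) :: l)

def parse (w : List Letter) : Option (List (ℕ × ℤ)) := parseAux 0 w

/-- Convert the `η`-signs (integral representation) to the `σ`-signs
(series representation): `σ₁ = η₁` and `σ_j = η_j · η_{j-1}` for `j ≥ 2`. -/
def etaToSigma : ℤ → List (ℕ × ℤ) → List (ℕ × ℤ)
  | _, [] => []
  | prev, (s, η) :: l => (s, η * prev) :: etaToSigma η l

/-- `T_p` of an admissible word `y₀^{s₁−1} y_{η₁} ⋯ y₀^{s_d−1} y_{η_d}` is the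
finite alternating multiple T-sum `T_p(s₁,…,s_d; σ₁,…,σ_d)` with `σ₁ = η₁`,
`σ_j = η_j·η_{j−1}`; `T_p` of the empty word is `1`. -/
noncomputable def TwordP (p : ℕ) (w : List Letter) : ZMod p :=
  match parse w with
  | none => 0
  | some blocks => TaltP p (etaToSigma 1 blocks)

/-- `T_p(u ⧢ v) = Σ_{w ∈ u ⧢ v} T_p(w)`, counted with multiplicity. -/
noncomputable def TshufP (p : ℕ) (u v : List Letter) : ZMod p :=
  ((shuffle u v).map (TwordP p)).sum

/-- The word `y₀^{s₁-1} y₁ ⋯ y₀^{s_d-1} y₁` attached to `(s₁, …, s_d)`. -/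
def wordOf (s : List ℕ) : List Letter :=
  (s.map (fun k => List.replicate (k - 1) Letter.y0 ++ [Letter.y1])).flatten

/-- The generating series `∑ c^((k-1)/2) t^k` over odd `k`. -/
noncomputable def oddGeom (p : ℕ) (c : ZMod p) : PowerSeries (ZMod p) :=
  PowerSeries.mk fun k => if Odd k then c ^ (k / 2) else 0

/-- The series `t • g(t)` where `g(t) dt` is the differential form attached to a letter. -/
noncomputable def Letter.kernel (p : ℕ) : Letter → PowerSeries (ZMod p)
  | Letter.y0 => 1
  | Letter.y1 => oddGeom p 1
  | Letter.ym1 => oddGeom p (-1)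

/-- Formal integration `f ↦ ∫ f dt/t`, with the junk value `0` on the coefficients whose
index is divisible by `p`. -/
noncomputable def eulerInt (p : ℕ) [Fact p.Prime] :
    PowerSeries (ZMod p) →+ PowerSeries (ZMod p) where
  toFun f := PowerSeries.mk fun n => (n : ZMod p)⁻¹ * PowerSeries.coeff n f
  map_zero' := by ext; simp
  map_add' f g := by ext; simp [mul_add]

/-- The iterated integral of a word as a power series over `ZMod p`. -/
noncomputable def wordSeries (p : ℕ) [Fact p.Prime] : List Letter → PowerSeries (ZMod p)
  | [] => 1
  | a :: w => eulerInt p (a.kernel p * wordSeries p w)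

section Shuffle

open PowerSeries

variable {p : ℕ} [Fact p.Prime]

lemma coeff_zero_mul_eq (f g : PowerSeries (ZMod p)) :
    coeff 0 (f * g) = coeff 0 f * coeff 0 g := by
  simp

lemma coeff_eulerInt (f : PowerSeries (ZMod p)) (n : ℕ) :
    coeff n (eulerInt p f) = (n : ZMod p)⁻¹ * coeff n f := by
  simp [eulerInt]

lemma coeff_X_mul_derivative (f : PowerSeries (ZMod p)) (n : ℕ) :
    coeff n (X * derivative (ZMod p) f) = n * coeff n f := by
  cases n with
  | zero => simp
  | succ n => rw [coeff_succ_X_mul, coeff_derivative]; push_cast; ring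

lemma natCast_ne_zero_of_pos_of_lt {n : ℕ} (h0 : 0 < n) (hn : n < p) : (n : ZMod p) ≠ 0 := by
  rw [Ne, ZMod.natCast_eq_zero_iff]
  exact Nat.not_dvd_of_pos_of_lt h0 hn

lemma X_pow_dvd_of_X_mul_derivative {f : PowerSeries (ZMod p)} (h0 : coeff 0 f = 0)
    (h : X ^ p ∣ X * derivative (ZMod p) f) : X ^ p ∣ f := by
  rw [X_pow_dvd_iff] at h ⊢
  intro n hn
  rcases Nat.eq_zero_or_pos n with rfl | hpos
  · exact h0
  · have := h n hn
    rw [coeff_X_mul_derivative] at this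
    exact (mul_eq_zero.1 this).resolve_left (natCast_ne_zero_of_pos_of_lt hpos hn)

lemma X_pow_dvd_X_mul_derivative_eulerInt {f : PowerSeries (ZMod p)} (h0 : coeff 0 f = 0) :
    X ^ p ∣ X * derivative (ZMod p) (eulerInt p f) - f := by
  rw [X_pow_dvd_iff]
  intro n hn
  rw [map_sub, coeff_X_mul_derivative, coeff_eulerInt]
  rcases Nat.eq_zero_or_pos n with rfl | hpos
  · simp [h0]
  · rw [mul_inv_cancel_left₀ (natCast_ne_zero_of_pos_of_lt hpos hn), sub_self]

lemma coeff_zero_wordSeries_cons (a : Letter) (w : List Letter) :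
    coeff 0 (wordSeries p (a :: w)) = 0 := by
  rw [wordSeries, coeff_eulerInt]; simp

lemma Admissible.of_cons {a : Letter} {w : List Letter} (h : Admissible (a :: w)) :
    Admissible w := by
  cases w with
  | nil => simp [Admissible]
  | cons b w => simpa [Admissible, List.getLast?_cons_cons] using h

lemma coeff_zero_kernel_mul_wordSeries {a : Letter} {w : List Letter}
    (h : Admissible (a :: w)) : coeff 0 (a.kernel p * wordSeries p w) = 0 := by
  rw [coeff_zero_mul_eq]
  cases a with
  | y0 =>
    cases w with
    | nil => simp [Admissible] at h
    | cons b w => rw [coeff_zero_wordSeries_cons, mul_zero]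
  | y1 => simp [Letter.kernel, oddGeom]
  | ym1 => simp [Letter.kernel, oddGeom]

lemma sum_map_wordSeries_cons (a : Letter) (m : Multiset (List Letter)) :
    ((m.map (List.cons a)).map (wordSeries p)).sum
      = eulerInt p (a.kernel p * (m.map (wordSeries p)).sum) := by
  rw [Multiset.map_map, ← Multiset.sum_map_mul_left, map_multiset_sum, Multiset.map_map]
  rfl

/-- The shuffle relation for iterated integrals, up to the order where division by `p` occurs. -/
lemma X_pow_dvd_sum_wordSeries_shuffle (u v : List Letter) (hu : Admissible u)
    (hv : Admissible v) :
    X ^ p ∣ ((shuffle u v).map (wordSeries p)).sum - wordSeries p u * wordSeries p v := by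
  fun_induction shuffle u v with
  | case1 v => simp [wordSeries]
  | case2 a u => simp [wordSeries]
  | case3 a u b v ih₁ ih₂ =>
    specialize ih₁ hu.of_cons hv
    specialize ih₂ hu hv.of_cons
    have hpos : 0 < p := (Fact.out : p.Prime).pos
    rw [Multiset.map_add, Multiset.sum_add, sum_map_wordSeries_cons, sum_map_wordSeries_cons]
    set S₁ := ((shuffle u (b :: v)).map (wordSeries p)).sum
    set S₂ := ((shuffle (a :: u) v).map (wordSeries p)).sum
    have hS₁ : coeff 0 (a.kernel p * S₁) = 0 := by
      have h := X_pow_dvd_iff.1 ih₁ 0 hpos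
      rw [map_sub, coeff_zero_mul_eq, coeff_zero_wordSeries_cons, mul_zero, sub_zero] at h
      rw [coeff_zero_mul_eq, h, mul_zero]
    have hS₂ : coeff 0 (b.kernel p * S₂) = 0 := by
      have h := X_pow_dvd_iff.1 ih₂ 0 hpos
      rw [map_sub, coeff_zero_mul_eq, coeff_zero_wordSeries_cons, zero_mul, sub_zero] at h
      rw [coeff_zero_mul_eq, h, mul_zero]
    apply X_pow_dvd_of_X_mul_derivative
    · rw [map_sub, map_add, coeff_eulerInt, coeff_eulerInt, hS₁, hS₂, coeff_zero_mul_eq,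
        coeff_zero_wordSeries_cons]
      simp
    · have e₁ := X_pow_dvd_X_mul_derivative_eulerInt hS₁
      have e₂ := X_pow_dvd_X_mul_derivative_eulerInt hS₂
      have e₃ := X_pow_dvd_X_mul_derivative_eulerInt (coeff_zero_kernel_mul_wordSeries (p := p) hu)
      have e₄ := X_pow_dvd_X_mul_derivative_eulerInt (coeff_zero_kernel_mul_wordSeries (p := p) hv)
      rw [← wordSeries] at e₃ e₄
      rw [map_sub, map_add, Derivation.leibniz, smul_eq_mul, smul_eq_mul]
      obtain ⟨c₁, e₁⟩ := e₁
      obtain ⟨c₂, e₂⟩ := e₂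
      obtain ⟨c₃, e₃⟩ := e₃
      obtain ⟨c₄, e₄⟩ := e₄
      obtain ⟨d₁, ih₁⟩ := ih₁
      obtain ⟨d₂, ih₂⟩ := ih₂
      refine ⟨c₁ + c₂ - c₃ * wordSeries p (b :: v) - wordSeries p (a :: u) * c₄
        + a.kernel p * d₁ + b.kernel p * d₂, ?_⟩
      linear_combination e₁ + e₂ - wordSeries p (b :: v) * e₃ - wordSeries p (a :: u) * e₄
        + a.kernel p * ih₁ + b.kernel p * ih₂

end Shuffle

/-- `n ↦ n^{-s} ∑ c^((n-m-1)/2) f m` over `m < n` of parity opposite to `n`. -/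
noncomputable def blockOp (p s : ℕ) (c : ZMod p) (f : ℕ → ZMod p) (n : ℕ) : ZMod p :=
  ((n : ZMod p) ^ s)⁻¹ * ∑ m ∈ Finset.range n, if Odd (n - m) then c ^ ((n - m) / 2) * f m else 0

/-- The coefficients of the iterated integral of a list of blocks. -/
noncomputable def blockCoeff (p : ℕ) : List (ℕ × ℤ) → ℕ → ZMod p
  | [] => fun n => if n = 0 then 1 else 0
  | (s, η) :: l => blockOp p s η (blockCoeff p l)

section Parse

open PowerSeries

variable {p : ℕ} [Fact p.Prime]

lemma coeff_oddGeom_mul (c : ZMod p) (f : PowerSeries (ZMod p)) (n : ℕ) :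
    coeff n (oddGeom p c * f)
      = ∑ m ∈ Finset.range n, if Odd (n - m) then c ^ ((n - m) / 2) * coeff m f else 0 := by
  rw [mul_comm, coeff_mul, Finset.Nat.sum_antidiagonal_eq_sum_range_succ_mk,
    Finset.sum_range_succ]
  simp [oddGeom, mul_comm]

lemma coeff_wordSeries_replicate_append (k : ℕ) (w : List Letter) (n : ℕ) :
    coeff n (wordSeries p (List.replicate k Letter.y0 ++ w))
      = ((n : ZMod p) ^ k)⁻¹ * coeff n (wordSeries p w) := by
  induction k with
  | zero => simp
  | succ k ih =>
    rw [List.replicate_succ, List.cons_append, wordSeries, coeff_eulerInt, Letter.kernel,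
      one_mul, ih, pow_succ, mul_inv]
    ring

lemma coeff_wordSeries_block {a : Letter} {c : ZMod p} (ha : a.kernel p = oddGeom p c)
    (k : ℕ) (w : List Letter) (n : ℕ) :
    coeff n (wordSeries p (List.replicate k Letter.y0 ++ a :: w))
      = blockOp p (k + 1) c (fun m => coeff m (wordSeries p w)) n := by
  rw [coeff_wordSeries_replicate_append, wordSeries, coeff_eulerInt, ha, coeff_oddGeom_mul,
    blockOp, pow_succ, mul_inv]
  ring

lemma coeff_wordSeries_of_parseAux (w : List Letter) (k n : ℕ) :
    coeff n (wordSeries p (List.replicate k Letter.y0 ++ w))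
      = ((parseAux k w).map fun l => blockCoeff p l n).getD 0 := by
  induction w generalizing k n with
  | nil =>
    rw [coeff_wordSeries_replicate_append, wordSeries, parseAux, coeff_one]
    rcases Nat.eq_zero_or_pos k with rfl | hk
    · simp [blockCoeff]
    · rcases Nat.eq_zero_or_pos n with rfl | hn
      · simp [hk.ne']
      · simp [hk.ne', hn.ne']
  | cons a w ih =>
    have key : ∀ m, coeff m (wordSeries p w)
        = ((parseAux 0 w).map fun l => blockCoeff p l m).getD 0 := fun m => ih 0 m
    cases a with
    | y0 =>
      rw [parseAux, ← ih, List.replicate_succ', List.append_assoc, List.singleton_append]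
    | y1 =>
      rw [parseAux, coeff_wordSeries_block rfl]
      simp_rw [key]
      cases parseAux 0 w with
      | none => simp [blockOp]
      | some l => simp [blockCoeff]
    | ym1 =>
      rw [parseAux, coeff_wordSeries_block rfl]
      simp_rw [key]
      cases parseAux 0 w with
      | none => simp [blockOp]
      | some l => simp [blockCoeff]

end Parse

lemma eq_one_or_neg_one_of_mem_parseAux {w : List Letter} {k : ℕ} {l : List (ℕ × ℤ)}
    (h : parseAux k w = some l) : ∀ b ∈ l, b.2 = 1 ∨ b.2 = -1 := by
  induction w generalizing k l with
  | nil =>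
    rw [parseAux] at h
    split_ifs at h
    simp_all
  | cons a w ih =>
    cases a with
    | y0 => exact ih h
    | y1 =>
      obtain ⟨l', h', rfl⟩ := Option.map_eq_some_iff.1 h
      simpa using fun a b hb => ih h' (a, b) hb
    | ym1 =>
      obtain ⟨l', h', rfl⟩ := Option.map_eq_some_iff.1 h
      simpa using fun a b hb => ih h' (a, b) hb

lemma etaToSigma_length (c : ℤ) (l : List (ℕ × ℤ)) : (etaToSigma c l).length = l.length := by
  induction l generalizing c with
  | nil => rfl
  | cons b l ih => simp [etaToSigma, ih]

/-- The sum `TaltP` restricted to `n₁ < N`. -/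
noncomputable def truncTaltP (p : ℕ) (l : List (ℕ × ℤ)) (N : ℕ) : ZMod p :=
  ∑ n : Fin l.length → Fin p,
    if (∀ j, (n j : ℕ) < N) ∧ (∀ j, 0 < (n j : ℕ)) ∧
       (∀ i j : Fin l.length, i < j → (n j : ℕ) < (n i : ℕ)) ∧
       (∀ j : Fin l.length, (n j : ℕ) % 2 = (l.length - (j : ℕ)) % 2)
    then ∏ j, ((l.get j).2 : ZMod p) ^ (((n j : ℕ) + (j : ℕ) - l.length) / 2) *
              (((n j : ℕ) : ZMod p) ^ (l.get j).1)⁻¹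
    else 0

lemma truncTaltP_self (p : ℕ) (l : List (ℕ × ℤ)) : truncTaltP p l p = TaltP p l := by
  simp [truncTaltP, TaltP]

lemma truncTaltP_cons (p s : ℕ) (σ : ℤ) (l : List (ℕ × ℤ)) {N : ℕ} (hN : N ≤ p) :
    truncTaltP p ((s, σ) :: l) N
      = ∑ n ∈ Finset.range N, if 0 < n ∧ n % 2 = (l.length + 1) % 2 then
          (σ : ZMod p) ^ ((n - (l.length + 1)) / 2) * ((n : ZMod p) ^ s)⁻¹ * truncTaltP p l n
        else 0 := by
  have hfilter : Finset.range N = (Finset.range p).filter (· < N) := by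
    ext n; simp only [Finset.mem_range, Finset.mem_filter]; omega
  rw [hfilter, Finset.sum_filter, ← Fin.sum_univ_eq_sum_range (fun n => if n < N then
    (if 0 < n ∧ n % 2 = (l.length + 1) % 2 then (σ : ZMod p) ^ ((n - (l.length + 1)) / 2) *
      ((n : ZMod p) ^ s)⁻¹ * truncTaltP p l n else 0) else 0) p]
  refine ((Fin.consEquiv (n := l.length) fun _ => Fin p).sum_comp _).symm.trans ?_
  rw [Fintype.sum_prod_type]
  refine Finset.sum_congr rfl fun a _ => ?_
  rw [← ite_and]
  split_ifs with h
  · rw [truncTaltP, Finset.mul_sum]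
    refine Finset.sum_congr rfl fun n _ => ?_
    rw [mul_ite, mul_zero]
    refine if_congr ?_ ?_ rfl
    · obtain ⟨haN, ha0, ha2⟩ := h
      simp only [List.length_cons, Fin.forall_fin_succ, Fin.consEquiv_apply, Fin.cons_zero,
        Fin.cons_succ, Fin.val_zero, Fin.val_succ, Fin.succ_lt_succ_iff, Fin.succ_pos,
        Fin.not_lt_zero, forall_true_left, false_imp_iff, true_and, tsub_zero,
        Nat.add_sub_add_right]
      constructor
      · rintro ⟨_, ⟨_, h0⟩, ⟨ha, hlt⟩, _, h2⟩
        exact ⟨ha, h0, hlt, h2⟩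
      · rintro ⟨ha, h0, hlt, h2⟩
        exact ⟨⟨haN, fun i => (ha i).trans haN⟩, ⟨ha0, h0⟩, ⟨ha, hlt⟩, ha2, h2⟩
    · refine (Fin.prod_univ_succ _).trans ?_
      refine congrArg₂ _ (by simp) (Finset.prod_congr rfl fun j _ => ?_)
      have e : (n j : ℕ) + (j + 1) - (l.length + 1) = n j + j - l.length := by omega
      simp [e]
  · refine Finset.sum_eq_zero fun n _ => if_neg fun hn => h ?_
    obtain ⟨h1, h2, -, h4⟩ := hn
    exact ⟨by simpa using h1 0, by simpa using h2 0, by simpa using h4 0⟩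

/-- A sequence supported on indices `n ≥ d` with `n ≡ d (mod 2)`. -/
def ParitySupported {p : ℕ} (d : ℕ) (f : ℕ → ZMod p) : Prop :=
  ∀ n, f n ≠ 0 → d ≤ n ∧ n % 2 = d % 2

lemma ParitySupported.blockOp {p : ℕ} {d : ℕ} {f : ℕ → ZMod p} (hf : ParitySupported d f)
    (s : ℕ) (c : ZMod p) : ParitySupported (d + 1) (blockOp p s c f) := by
  intro n hn
  obtain ⟨m, hm, h⟩ := Finset.exists_ne_zero_of_sum_ne_zero (right_ne_zero_of_mul hn)
  rw [Finset.mem_range] at hm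
  rw [ne_eq, ite_eq_right_iff, Classical.not_imp] at h
  obtain ⟨hodd, hm'⟩ := h
  have := hf m (right_ne_zero_of_mul hm')
  rw [Nat.odd_iff] at hodd
  omega

lemma paritySupported_blockCoeff (p : ℕ) (l : List (ℕ × ℤ)) :
    ParitySupported l.length (blockCoeff p l) := by
  induction l with
  | nil =>
    intro n hn
    rw [blockCoeff, ne_eq, ite_eq_right_iff, Classical.not_imp] at hn
    simp [hn.1]
  | cons b l ih => exact ih.blockOp _ _

lemma truncTaltP_etaToSigma (p : ℕ) (l : List (ℕ × ℤ)) (hl : ∀ b ∈ l, b.2 = 1 ∨ b.2 = -1)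
    (c : ℤ) {N : ℕ} (hN0 : 0 < N) (hN : N ≤ p) :
    truncTaltP p (etaToSigma c l) N
      = ∑ n ∈ Finset.range N, (c : ZMod p) ^ ((n - l.length) / 2) * blockCoeff p l n := by
  induction l generalizing c N with
  | nil =>
    rw [Finset.sum_eq_single_of_mem 0 (by simpa using hN0)]
    · have h : truncTaltP p [] N = 1 := by
        rw [truncTaltP]
        exact (Fintype.sum_unique (ι := Fin 0 → Fin p) _).trans (by simp)
      simp [etaToSigma, h, blockCoeff]
    · intro n _ hn
      simp [blockCoeff, hn]
  | cons b l ih =>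
    obtain ⟨s, η⟩ := b
    have hη : (η : ZMod p) * η = 1 := by
      rcases hl (s, η) (by simp) with h | h <;> simp only at h <;> simp [h]
    rw [etaToSigma, truncTaltP_cons _ _ _ _ hN]
    refine Finset.sum_congr rfl fun n hn => ?_
    rw [Finset.mem_range] at hn
    have hsupp := paritySupported_blockCoeff p ((s, η) :: l) n
    rw [List.length_cons] at hsupp
    rw [etaToSigma_length]
    split_ifs with h
    · rw [ih (fun b hb => hl b (List.mem_cons_of_mem _ hb)) η h.1 (hn.le.trans hN), blockCoeff,
        blockOp, List.length_cons, Int.cast_mul, mul_pow, Finset.mul_sum, Finset.mul_sum,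
        Finset.mul_sum]
      refine Finset.sum_congr rfl fun m hm => ?_
      rw [Finset.mem_range] at hm
      by_cases hm0 : blockCoeff p l m = 0
      · simp [hm0]
      · have hm' := paritySupported_blockCoeff p l m hm0
        have hodd : Odd (n - m) := by rw [Nat.odd_iff]; omega
        have e : (n - (l.length + 1)) / 2 = (m - l.length) / 2 + (n - m) / 2 := by
          rw [Nat.odd_iff] at hodd; omega
        have e' : (η : ZMod p) ^ ((m - l.length) / 2) * (η : ZMod p) ^ ((m - l.length) / 2) = 1 := by
          rw [← mul_pow, hη, one_pow]
        rw [if_pos hodd, e, pow_add, pow_add]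
        linear_combination (η : ZMod p) ^ ((n - m) / 2) * (c : ZMod p) ^ ((m - l.length) / 2) *
          (c : ZMod p) ^ ((n - m) / 2) * ((n : ZMod p) ^ s)⁻¹ * blockCoeff p l m * e'
    · by_cases h0 : blockCoeff p ((s, η) :: l) n = 0
      · rw [h0, mul_zero]
      · have := hsupp h0
        exact absurd ⟨by omega, this.2⟩ h

lemma TwordP_eq_sum_coeff {p : ℕ} [Fact p.Prime] (w : List Letter) :
    TwordP p w = ∑ n ∈ Finset.range p, PowerSeries.coeff n (wordSeries p w) := by
  have key := fun n => coeff_wordSeries_of_parseAux (p := p) w 0 n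
  simp only [List.replicate_zero, List.nil_append] at key
  simp_rw [key]
  rw [TwordP, parse]
  cases h : parseAux 0 w with
  | none => simp
  | some l =>
    simp only
    rw [← truncTaltP_self, truncTaltP_etaToSigma p l (eq_one_or_neg_one_of_mem_parseAux h) 1
      (Fact.out : p.Prime).pos le_rfl]
    simp

lemma length_of_parseAux {w : List Letter} {k : ℕ} {l : List (ℕ × ℤ)}
    (h : parseAux k w = some l) : l.length = depth w := by
  induction w generalizing k l with
  | nil =>
    rw [parseAux] at h
    split_ifs at h
    simp_all [depth]
  | cons a w ih =>
    cases a with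
    | y0 => simpa [depth] using ih h
    | y1 =>
      obtain ⟨l', h', rfl⟩ := Option.map_eq_some_iff.1 h
      simpa [depth] using ih h'
    | ym1 =>
      obtain ⟨l', h', rfl⟩ := Option.map_eq_some_iff.1 h
      simpa [depth] using ih h'

lemma paritySupported_coeff_wordSeries {p : ℕ} [Fact p.Prime] (w : List Letter) :
    ParitySupported (depth w) fun n => PowerSeries.coeff n (wordSeries p w) := by
  intro n hn
  have key := coeff_wordSeries_of_parseAux (p := p) w 0 n
  rw [List.replicate_zero, List.nil_append] at key
  simp only [key] at hn
  cases h : parseAux 0 w with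
  | none => simp [h] at hn
  | some l =>
    rw [← length_of_parseAux h]
    exact paritySupported_blockCoeff p l n (by simpa [h] using hn)

/-- The pairing `∑ f i * g j` over `i + j < p` with `i + j` even. -/
noncomputable def evenPairing (p : ℕ) (f g : ℕ → ZMod p) : ZMod p :=
  ∑ i ∈ Finset.range p, ∑ j ∈ Finset.range p, if i + j < p ∧ Even (i + j) then f i * g j else 0

lemma blockOp_one_eq {p s n : ℕ} (f : ℕ → ZMod p) (hn : n < p) :
    blockOp p s 1 f n
      = ∑ m ∈ Finset.range p, if m < n ∧ Odd (n - m) then ((n : ZMod p) ^ s)⁻¹ * f m else 0 := by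
  have hfilter : Finset.range n = (Finset.range p).filter (· < n) := by
    ext m; simp only [Finset.mem_range, Finset.mem_filter]; omega
  rw [blockOp, hfilter, Finset.sum_filter, Finset.mul_sum]
  refine Finset.sum_congr rfl fun m _ => ?_
  rw [ite_and, mul_ite, mul_ite]
  simp

/-- The substitution `n ↦ p - n` makes `blockOp` self-adjoint up to sign. -/
lemma evenPairing_blockOp {p : ℕ} [Fact p.Prime] (hp : Odd p) (s : ℕ) (f g : ℕ → ZMod p) :
    evenPairing p (blockOp p s 1 f) g = (-1) ^ s * evenPairing p f (blockOp p s 1 g) := by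
  have hL : evenPairing p (blockOp p s 1 f) g
      = ∑ k ∈ Finset.range p, ∑ m ∈ Finset.range p, ∑ n ∈ Finset.range p,
        if (n + m < p ∧ Even (n + m)) ∧ k < n ∧ Odd (n - k) then
          ((n : ZMod p) ^ s)⁻¹ * f k * g m else 0 := by
    have : ∀ n ∈ Finset.range p, ∀ m, (if n + m < p ∧ Even (n + m) then
        blockOp p s 1 f n * g m else 0) = ∑ k ∈ Finset.range p,
          if (n + m < p ∧ Even (n + m)) ∧ k < n ∧ Odd (n - k) then
            ((n : ZMod p) ^ s)⁻¹ * f k * g m else 0 := by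
      intro n hn m
      rw [blockOp_one_eq f (Finset.mem_range.1 hn), Finset.sum_mul]
      split_ifs with h
      · simp [h]
      · simp [h]
    rw [evenPairing, Finset.sum_congr rfl fun n hn => Finset.sum_congr rfl fun m _ => this n hn m]
    rw [Finset.sum_congr rfl fun n _ => Finset.sum_comm, Finset.sum_comm]
    exact Finset.sum_congr rfl fun k _ => Finset.sum_comm
  have hR : evenPairing p f (blockOp p s 1 g)
      = ∑ k ∈ Finset.range p, ∑ m ∈ Finset.range p, ∑ n ∈ Finset.range p,
        if (k + n < p ∧ Even (k + n)) ∧ m < n ∧ Odd (n - m) then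
          ((n : ZMod p) ^ s)⁻¹ * f k * g m else 0 := by
    rw [evenPairing]
    refine Finset.sum_congr rfl fun k _ => ?_
    rw [Finset.sum_comm]
    refine Finset.sum_congr rfl fun n hn => ?_
    rw [blockOp_one_eq g (Finset.mem_range.1 hn), Finset.mul_sum]
    split_ifs with h
    · refine Finset.sum_congr rfl fun m _ => ?_
      simp only [h, true_and, and_self]
      split_ifs <;> ring
    · simp [h]
  rw [hL, hR, Finset.mul_sum]
  refine Finset.sum_congr rfl fun k _ => ?_
  rw [Finset.mul_sum]
  refine Finset.sum_congr rfl fun m _ => ?_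
  rw [← Finset.sum_filter, ← Finset.sum_filter, Finset.mul_sum]
  refine Finset.sum_nbij' (fun n => p - n) (fun n => p - n) ?_ ?_ ?_ ?_ ?_
  · intro n hn
    simp only [Finset.mem_filter, Finset.mem_range, Nat.even_iff, Nat.odd_iff] at hn hp ⊢
    omega
  · intro n hn
    simp only [Finset.mem_filter, Finset.mem_range, Nat.even_iff, Nat.odd_iff] at hn hp ⊢
    omega
  · intro n hn
    simp only [Finset.mem_filter, Finset.mem_range] at hn
    omega
  · intro n hn
    simp only [Finset.mem_filter, Finset.mem_range] at hn
    omega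
  · intro n hn
    simp only [Finset.mem_filter, Finset.mem_range] at hn
    rw [Nat.cast_sub hn.1.le, ZMod.natCast_self, zero_sub, neg_pow (n : ZMod p) s, mul_inv,
      ← inv_pow (-1 : ZMod p), inv_neg_one]
    have h : ((-1 : ZMod p) ^ s) * (-1) ^ s = 1 := by rw [← mul_pow]; simp
    linear_combination -(((n : ZMod p) ^ s)⁻¹ * f k * g m) * h

lemma wordOf_cons_append (k : ℕ) (s : List ℕ) (w : List Letter) :
    wordOf (k :: s) ++ w = List.replicate (k - 1) Letter.y0 ++ Letter.y1 :: (wordOf s ++ w) := by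
  simp [wordOf]

lemma wordOf_append (s t : List ℕ) : wordOf (s ++ t) = wordOf s ++ wordOf t := by
  simp [wordOf]

lemma admissible_wordOf (s : List ℕ) : Admissible (wordOf s) := by
  rcases List.eq_nil_or_concat s with rfl | ⟨t, k, rfl⟩
  · simp [Admissible, wordOf]
  · simp [Admissible, wordOf]

lemma depth_append (u v : List Letter) : depth (u ++ v) = depth u + depth v := by
  simp [depth]

lemma depth_wordOf (s : List ℕ) : depth (wordOf s) = s.length := by
  induction s with
  | nil => rfl
  | cons k s ih =>
    have h := wordOf_cons_append k s []
    rw [List.append_nil, List.append_nil] at h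
    rw [h, depth_append]
    simp [depth] at ih ⊢
    omega

section Main

open PowerSeries

variable {p : ℕ} [Fact p.Prime]

lemma coeff_wordSeries_wordOf_cons {k : ℕ} (hk : 0 < k) (s : List ℕ) (w : List Letter) :
    (fun n => coeff n (wordSeries p (wordOf (k :: s) ++ w)))
      = blockOp p k 1 fun n => coeff n (wordSeries p (wordOf s ++ w)) := by
  funext n
  rw [wordOf_cons_append, coeff_wordSeries_block rfl, Nat.sub_add_cancel hk]

lemma evenPairing_wordOf (hp : Odd p) (s : List ℕ) (hs : ∀ x ∈ s, 0 < x) (v : List Letter) :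
    evenPairing p (fun n => coeff n (wordSeries p (wordOf s)))
        (fun n => coeff n (wordSeries p v))
      = (-1) ^ s.sum * evenPairing p (fun n => coeff n (wordSeries p []))
        (fun n => coeff n (wordSeries p (wordOf s.reverse ++ v))) := by
  induction s generalizing v with
  | nil => simp [wordOf]
  | cons k s ih =>
    have hk : 0 < k := hs k (by simp)
    have e := coeff_wordSeries_wordOf_cons (p := p) hk s []
    have e' := coeff_wordSeries_wordOf_cons (p := p) hk [] v
    rw [List.append_nil, List.append_nil] at e
    rw [e, evenPairing_blockOp hp]
    change _ * evenPairing p _ (blockOp p k 1 fun n => coeff n (wordSeries p (wordOf [] ++ v))) = _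
    rw [← e', ih fun x hx => hs x (List.mem_cons_of_mem _ hx)]
    rw [List.reverse_cons, wordOf_append, List.append_assoc, List.sum_cons, pow_add, mul_assoc]

lemma evenPairing_nil (w : List Letter) (hw : Even (depth w)) :
    evenPairing p (fun n => coeff n (wordSeries p [])) (fun n => coeff n (wordSeries p w))
      = TwordP p w := by
  have hpos : 0 < p := (Fact.out : p.Prime).pos
  rw [TwordP_eq_sum_coeff, evenPairing, Finset.sum_eq_single_of_mem 0 (by simpa using hpos)]
  · refine Finset.sum_congr rfl fun n hn => ?_
    by_cases h0 : coeff n (wordSeries p w) = 0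
    · simp [h0]
    · have := paritySupported_coeff_wordSeries w n h0
      have hn2 : Even n := by rw [Nat.even_iff] at hw ⊢; omega
      rw [Finset.mem_range] at hn
      simp [hn, hn2, wordSeries]
  · intro n _ hn
    simp [wordSeries, coeff_one, hn]

lemma TshufP_eq_evenPairing (u v : List Letter) (hu : Admissible u) (hv : Admissible v)
    (h : Even (depth u + depth v)) :
    TshufP p u v = evenPairing p (fun n => coeff n (wordSeries p u))
      (fun n => coeff n (wordSeries p v)) := by
  have h₁ : TshufP p u v
      = ∑ n ∈ Finset.range p, coeff n (((shuffle u v).map (wordSeries p)).sum) := by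
    rw [TshufP, funext TwordP_eq_sum_coeff, Multiset.sum_map_sum]
    refine Finset.sum_congr rfl fun n _ => ?_
    rw [map_multiset_sum, Multiset.map_map]
    rfl
  have h₂ : ∀ n ∈ Finset.range p, coeff n (((shuffle u v).map (wordSeries p)).sum)
      = coeff n (wordSeries p u * wordSeries p v) := fun n hn => by
    have := X_pow_dvd_iff.1 (X_pow_dvd_sum_wordSeries_shuffle (p := p) u v hu hv) n
      (Finset.mem_range.1 hn)
    rwa [map_sub, sub_eq_zero] at this
  rw [h₁, Finset.sum_congr rfl h₂]
  simp_rw [coeff_mul]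
  rw [Finset.sum_sigma', evenPairing, ← Finset.sum_product', ← Finset.sum_filter]
  symm
  refine Finset.sum_of_injOn (fun x => ⟨x.1 + x.2, x⟩) ?_ ?_ ?_ ?_
  · intro x _ y _ hxy
    simp_all
  · intro x hx
    simp_all
  · rintro ⟨n, i, j⟩ hx hx'
    rw [Finset.mem_sigma, Finset.mem_range, Finset.HasAntidiagonal.mem_antidiagonal] at hx
    obtain ⟨hn, hij⟩ := hx
    dsimp only at hn hij
    subst hij
    by_contra hne
    have hi := paritySupported_coeff_wordSeries u i (left_ne_zero_of_mul hne)
    have hj := paritySupported_coeff_wordSeries v j (right_ne_zero_of_mul hne)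
    refine hx' ⟨(i, j), ?_, rfl⟩
    rw [Nat.even_iff] at h
    simp only [Finset.coe_filter, Finset.mem_product, Finset.mem_range, Set.mem_ofPred_eq,
      Nat.even_iff]
    omega
  · intro x _
    rfl

end Main

/-- For `u = y₀^{s₁−1} y₁ ⋯ y₀^{s_d−1} y₁` (a word over `{y₀, y₁}`) and an
admissible word `v` over `{y₀, y₁, y₋₁}` with `depth u + depth v` even, and
every odd prime `p`:
`T_p(u ⧢ v) = (−1)^{s₁+⋯+s_d} T_p(y₀^{s_d−1} y₁ ⋯ y₀^{s₁−1} y₁ · v)`. -/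
theorem linear_shuffle_FAMTV_i (s : List ℕ) (hs : ∀ x ∈ s, 0 < x)
    (v : List Letter) (hv : Admissible v)
    (hdep : Even (depth (wordOf s) + depth v))
    (p : ℕ) (hp : p.Prime) (hp2 : p ≠ 2) :
    TshufP p (wordOf s) v
      = (-1 : ZMod p) ^ s.sum * TwordP p (wordOf s.reverse ++ v) := by
  have : Fact p.Prime := ⟨hp⟩
  rw [TshufP_eq_evenPairing _ _ (admissible_wordOf s) hv hdep,
    evenPairing_wordOf (hp.odd_of_ne_two hp2) s hs, evenPairing_nil]
  rwa [depth_append, depth_wordOf, List.length_reverse, ← depth_wordOf]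
end

section
/- Let k be an odd positive integer and let ℓ be an integer with 0 ≤ ℓ ≤ k. Then for every prime p > k+2, T_p({1}^ℓ, 2, {1}^{k−ℓ}) = ((−1)^ℓ · (ℓ+1)^{−1} · C(k+1, ℓ)) · T_p(2, {1}^k) in ℤ/pℤ, where C(k+1,ℓ) is the binomial coefficient and ℓ+1 < p is invertible mod p. -/
open scoped Classical

/-- Finite multiple T-sum `T_p(s₁,…,s_d)`: the sum over
`p > n₁ > ⋯ > n_d > 0` with `n_j ≡ d−j+1 (mod 2)` (1-based) of `∏ n_j^{−s_j}`
in `ℤ/pℤ` (indices written 0-based below). -/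
noncomputable def TsumP (p : ℕ) (s : List ℕ) : ZMod p :=
  ∑ n : Fin s.length → Fin p,
    if (∀ j, 0 < (n j : ℕ)) ∧ (∀ i j : Fin s.length, i < j → (n j : ℕ) < (n i : ℕ)) ∧
       (∀ j : Fin s.length, (n j : ℕ) % 2 = (s.length - (j : ℕ)) % 2)
    then ∏ j, (((n j : ℕ) : ZMod p) ^ s.get j)⁻¹
    else 0

/-- `chainSum p s n` is the part of the finite multiple T-sum of `s` in which the largest index
is `n`; for the empty `s` it is the indicator of `n = 0`. -/
noncomputable def chainSum (p : ℕ) : List ℕ → ℕ → ZMod p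
  | [], n => if n = 0 then 1 else 0
  | a :: s, n => if 0 < n ∧ n % 2 = (s.length + 1) % 2 then
      ((n : ZMod p) ^ a)⁻¹ * ∑ m ∈ Finset.range n, chainSum p s m else 0

lemma chainSum_eq_zero_of_parity (p : ℕ) (s : List ℕ) (n : ℕ) (h : n % 2 ≠ s.length % 2) :
    chainSum p s n = 0 := by
  cases s with
  | nil =>
    rw [chainSum, if_neg]
    rintro rfl
    simp at h
  | cons a s =>
    rw [chainSum, if_neg]
    rintro ⟨-, h'⟩
    exact h (by simpa using h')

lemma sum_chains_lt_eq_sum_chainSum (p : ℕ) (s : List ℕ) (N : ℕ) (hN : 0 < N) (hNp : N ≤ p) :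
    (∑ n : Fin s.length → Fin p,
      if (∀ j, (n j : ℕ) < N) ∧ (∀ j, 0 < (n j : ℕ)) ∧
        (∀ i j : Fin s.length, i < j → (n j : ℕ) < (n i : ℕ)) ∧
        (∀ j : Fin s.length, (n j : ℕ) % 2 = (s.length - (j : ℕ)) % 2)
      then ∏ j, (((n j : ℕ) : ZMod p) ^ s.get j)⁻¹ else 0) =
      ∑ m ∈ Finset.range N, chainSum p s m := by
  induction s generalizing N with
  | nil => simp [chainSum, hN]
  | cons a s ih =>
    have hrange : ∑ m ∈ Finset.range N, chainSum p (a :: s) m =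
        ∑ x : Fin p, if (x : ℕ) < N then chainSum p (a :: s) x else 0 := by
      rw [Fin.sum_univ_eq_sum_range (fun m => if m < N then chainSum p (a :: s) m else 0),
        ← Finset.sum_filter]
      congr 1
      ext m
      simp only [Finset.mem_filter, Finset.mem_range]
      omega
    rw [hrange]
    refine (Equiv.sum_comp (Fin.consEquiv fun _ : Fin (s.length + 1) => Fin p) _).symm.trans ?_
    rw [Fintype.sum_prod_type]
    refine Finset.sum_congr rfl fun x _ => ?_
    rw [chainSum]
    by_cases hx : (x : ℕ) < N ∧ 0 < (x : ℕ) ∧ (x : ℕ) % 2 = (s.length + 1) % 2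
    · obtain ⟨hxN, hx0, hx2⟩ := hx
      rw [if_pos hxN, if_pos ⟨hx0, hx2⟩, ← ih x hx0 x.isLt.le, Finset.mul_sum]
      refine Finset.sum_congr rfl fun y _ => ?_
      rw [mul_ite, mul_zero]
      refine if_congr ?_ ?_ rfl
      · simp only [List.length_cons, Fin.forall_fin_succ, Fin.consEquiv, Equiv.coe_fn_mk,
          Fin.cons_zero, Fin.cons_succ, Fin.succ_lt_succ_iff, Fin.succ_pos, Fin.val_zero,
          Fin.val_succ, Nat.add_sub_add_right, Fin.not_lt_zero, false_imp_iff,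
          true_imp_iff, true_and]
        constructor
        · rintro ⟨⟨-, -⟩, ⟨-, h1⟩, ⟨h2, h3⟩, -, h4⟩
          exact ⟨h2, h1, h3, h4⟩
        · rintro ⟨h2, h1, h3, h4⟩
          exact ⟨⟨hxN, fun j => (h2 j).trans hxN⟩, ⟨hx0, h1⟩, ⟨h2, h3⟩, hx2, h4⟩
      · exact Fin.prod_univ_succ _
    · have hz : (if (x : ℕ) < N then if 0 < (x : ℕ) ∧ (x : ℕ) % 2 = (s.length + 1) % 2 then
          (((x : ℕ) : ZMod p) ^ a)⁻¹ * ∑ m ∈ Finset.range x, chainSum p s m else 0 else 0) = 0 := by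
        split_ifs with h1 h2
        · exact absurd ⟨h1, h2⟩ hx
        · rfl
        · rfl
      rw [hz]
      refine Finset.sum_eq_zero fun y _ => if_neg ?_
      rintro ⟨h1, h2, -, h4⟩
      exact hx ⟨h1 (0 : Fin (s.length + 1)), h2 (0 : Fin (s.length + 1)),
        h4 (0 : Fin (s.length + 1))⟩

lemma TsumP_eq_sum_chainSum (p : ℕ) (hp : 0 < p) (s : List ℕ) :
    TsumP p s = ∑ m ∈ Finset.range p, chainSum p s m := by
  rw [← sum_chains_lt_eq_sum_chainSum p s p hp le_rfl, TsumP]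
  refine Finset.sum_congr rfl fun n _ => if_congr ?_ rfl rfl
  exact ⟨fun h => ⟨fun j => (n j).isLt, h⟩, fun h => h.2⟩

/-- The power series `∑ tⁿ / n` over odd `n` prime to `p`, a mod `p` analogue of `artanh`. -/
noncomputable def oddLog (p : ℕ) : PowerSeries (ZMod p) :=
  PowerSeries.mk fun n => if n % 2 = 1 then (n : ZMod p)⁻¹ else 0

lemma coeff_zero_oddLog_pow_succ (p j : ℕ) :
    PowerSeries.coeff 0 (oddLog p ^ (j + 1)) = 0 := by
  simp [oddLog]

lemma natCast_ne_zero_of_lt {p n : ℕ} (h0 : 0 < n) (h : n < p) : (n : ZMod p) ≠ 0 := by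
  rw [Ne, ZMod.natCast_eq_zero_iff]
  exact Nat.not_dvd_of_pos_of_lt h0 h

section

variable {p : ℕ} [Fact p.Prime]

lemma natCast_mul_coeff_oddLog_pow (j n : ℕ) (hn : n < p) :
    (n : ZMod p) * PowerSeries.coeff n (oddLog p ^ (j + 1)) =
      (j + 1) * ∑ m ∈ Finset.range n,
        if (n - m) % 2 = 1 then PowerSeries.coeff m (oddLog p ^ j) else 0 := by
  cases n with
  | zero => simp
  | succ n =>
    have h := congrArg (PowerSeries.coeff n)
      ((PowerSeries.derivative (ZMod p)).leibniz_pow (oddLog p) (j + 1))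
    simp only [PowerSeries.coeff_derivative, Nat.add_sub_cancel, smul_eq_mul, nsmul_eq_mul] at h
    rw [Nat.cast_succ, mul_comm, h, ← nsmul_eq_mul, map_nsmul, nsmul_eq_mul, Nat.cast_succ,
      PowerSeries.coeff_mul, Finset.Nat.sum_antidiagonal_eq_sum_range_succ_mk]
    congr 1
    refine Finset.sum_congr rfl fun m hm => ?_
    have hm : m < n + 1 := Finset.mem_range.mp hm
    have hne := natCast_ne_zero_of_lt (p := p) (n := n - m + 1) (by omega) (by omega)
    simp only [PowerSeries.coeff_derivative, oddLog, PowerSeries.coeff_mk]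
    rw [show n + 1 - m = n - m + 1 by omega]
    push_cast at hne ⊢
    split_ifs
    · rw [inv_mul_cancel₀ hne, mul_one]
    · simp

lemma sum_range_chainSum_of_parity (s : List ℕ) (n : ℕ) (hn : n % 2 = (s.length + 1) % 2) :
    ∑ m ∈ Finset.range n, chainSum p s m =
      ∑ m ∈ Finset.range n, if (n - m) % 2 = 1 then chainSum p s m else 0 := by
  refine Finset.sum_congr rfl fun m hm => ?_
  have hm := Finset.mem_range.mp hm
  split_ifs with h
  · rfl
  · exact chainSum_eq_zero_of_parity p s m (by omega)

lemma coeff_oddLog_pow_eq_zero_of_parity (j n : ℕ) (h : n % 2 ≠ j % 2) (hn : n < p) :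
    PowerSeries.coeff n (oddLog p ^ j) = 0 := by
  induction j generalizing n with
  | zero =>
    rw [pow_zero, PowerSeries.coeff_one, if_neg]
    rintro rfl
    simp at h
  | succ j ih =>
    rcases Nat.eq_zero_or_pos n with rfl | h0
    · exact coeff_zero_oddLog_pow_succ p j
    · refine (mul_eq_zero.mp ?_).resolve_left (natCast_ne_zero_of_lt h0 hn)
      rw [natCast_mul_coeff_oddLog_pow j n hn, Finset.sum_eq_zero, mul_zero]
      intro m hm
      have hm := Finset.mem_range.mp hm
      split_ifs with h'
      · exact ih m (by omega) (by omega)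
      · rfl

lemma factorial_mul_chainSum_replicate_one (j n : ℕ) (hn : n < p) :
    (j.factorial : ZMod p) * chainSum p (List.replicate j 1) n =
      PowerSeries.coeff n (oddLog p ^ j) := by
  induction j generalizing n with
  | zero => simp [chainSum, PowerSeries.coeff_one]
  | succ j ih =>
    by_cases h : 0 < n ∧ n % 2 = (j + 1) % 2
    · have hne := natCast_ne_zero_of_lt h.1 hn
      refine mul_left_cancel₀ hne ?_
      rw [natCast_mul_coeff_oddLog_pow j n hn, List.replicate_succ, chainSum,
        if_pos (by simpa using h), sum_range_chainSum_of_parity _ _ (by simpa using h.2), pow_one,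
        mul_left_comm, mul_inv_cancel_left₀ hne, Nat.factorial_succ, Nat.cast_mul, mul_assoc,
        Nat.cast_succ, Finset.mul_sum]
      congr 1
      refine Finset.sum_congr rfl fun m hm => ?_
      rw [mul_ite, mul_zero, ih m ((Finset.mem_range.mp hm).trans hn)]
    · rw [List.replicate_succ, chainSum, if_neg (by simpa using h), mul_zero]
      rcases Nat.eq_zero_or_pos n with rfl | h0
      · exact (coeff_zero_oddLog_pow_succ p j).symm
      · exact (coeff_oddLog_pow_eq_zero_of_parity (j + 1) n (fun h' => h ⟨h0, h'⟩) hn).symm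

lemma natCast_mul_chainSum_one_cons (s : List ℕ) (n : ℕ) (hn : n < p) :
    (n : ZMod p) * chainSum p (1 :: s) n =
      ∑ m ∈ Finset.range p, if m < n ∧ (n - m) % 2 = 1 then chainSum p s m else 0 := by
  by_cases h : 0 < n ∧ n % 2 = (s.length + 1) % 2
  · rw [chainSum, if_pos h, pow_one, mul_inv_cancel_left₀ (natCast_ne_zero_of_lt h.1 hn),
      sum_range_chainSum_of_parity _ _ h.2]
    refine Finset.sum_subset_zero_on_sdiff (Finset.range_mono hn.le) (fun m hm => ?_)
      fun m hm => ?_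
    · exact if_neg fun h' => (Finset.mem_sdiff.mp hm).2 (Finset.mem_range.mpr h'.1)
    · simp only [Finset.mem_range.mp hm, true_and]
  · rw [chainSum, if_neg h, mul_zero, Finset.sum_eq_zero]
    intro m _
    split_ifs with h'
    · exact chainSum_eq_zero_of_parity p s m (by omega)
    · rfl

/-- Summing out a block of leading ones. -/
lemma factorial_mul_sum_chainSum_replicate_append (hp2 : p ≠ 2) (l a : ℕ) (s : List ℕ)
    (hpar : (l + (s.length + 1)) % 2 = 0) :
    ((l + 1).factorial : ZMod p) *
        ∑ n ∈ Finset.range p, chainSum p (List.replicate l 1 ++ a :: s) n =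
      (-1) ^ (l + 1) * ∑ n ∈ Finset.range p, chainSum p (a :: s) n *
        (n * PowerSeries.coeff (p - n) (oddLog p ^ (l + 1))) := by
  have hodd : p % 2 = 1 := (Fact.out : p.Prime).eq_two_or_odd.resolve_left hp2
  induction l generalizing a s with
  | zero =>
    simp only [List.replicate_zero, List.nil_append, Nat.factorial_one, Nat.cast_one, one_mul,
      zero_add, pow_one]
    rw [Finset.mul_sum]
    refine Finset.sum_congr rfl fun n hn => ?_
    have hn := Finset.mem_range.mp hn
    by_cases h : 0 < n ∧ n % 2 = (s.length + 1) % 2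
    · have hne := natCast_ne_zero_of_lt h.1 hn
      rw [oddLog, PowerSeries.coeff_mk, if_pos (by omega), Nat.cast_sub hn.le, ZMod.natCast_self,
        zero_sub, inv_neg, mul_neg, mul_inv_cancel₀ hne]
      ring
    · rw [chainSum, if_neg h]
      simp
  | succ l ih =>
    have hlist : List.replicate (l + 1) 1 ++ a :: s = List.replicate l 1 ++ 1 :: a :: s := by
      rw [List.replicate_succ']
      simp
    have hterm : ∀ n ∈ Finset.range p, chainSum p (1 :: a :: s) n *
        (n * PowerSeries.coeff (p - n) (oddLog p ^ (l + 1))) =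
        ∑ m ∈ Finset.range p, if m < n ∧ (n - m) % 2 = 1 then
          chainSum p (a :: s) m * PowerSeries.coeff (p - n) (oddLog p ^ (l + 1)) else 0 := by
      intro n hn
      rw [← mul_assoc, mul_comm (chainSum _ _ _),
        natCast_mul_chainSum_one_cons _ n (Finset.mem_range.mp hn), Finset.sum_mul]
      exact Finset.sum_congr rfl fun m _ => by rw [ite_mul, zero_mul]
    rw [hlist, Nat.factorial_succ, Nat.cast_mul, mul_assoc,
      ih 1 (a :: s) (by simp only [List.length_cons]; omega), Finset.sum_congr rfl hterm,
      Finset.sum_comm, pow_succ _ (l + 1), mul_left_comm, mul_assoc, Finset.mul_sum, neg_one_mul,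
      ← Finset.sum_neg_distrib]
    congr 1
    refine Finset.sum_congr rfl fun m hm => ?_
    have hm := Finset.mem_range.mp hm
    rcases Nat.eq_zero_or_pos m with rfl | h0
    · have hz : chainSum p (a :: s) 0 = 0 := by simp [chainSum]
      simp [hz]
    have hrec := natCast_mul_coeff_oddLog_pow (p := p) (l + 1) (p - m) (by omega)
    rw [Nat.cast_sub hm.le, ZMod.natCast_self, zero_sub] at hrec
    rw [← mul_neg, ← neg_mul, hrec, mul_left_comm]
    push_cast
    congr 1
    let g : ℕ → ZMod p := fun x => if x < p - m ∧ (p - m - x) % 2 = 1 then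
      chainSum p (a :: s) m * PowerSeries.coeff x (oddLog p ^ (l + 1)) else 0
    have hg0 : g (p - p) = 0 := by
      simp only [g, Nat.sub_self, coeff_zero_oddLog_pow_succ, mul_zero, ite_self]
    calc _ = ∑ n ∈ Finset.range p, g (p - n) :=
          Finset.sum_congr rfl fun n hn => by
            have hn := Finset.mem_range.mp hn
            exact if_congr (by omega) rfl rfl
      _ = ∑ n ∈ Finset.range (p + 1), g n := by
          rw [← Finset.sum_range_reflect g, Finset.sum_range_succ]
          simp only [Nat.add_sub_cancel, hg0, add_zero]
      _ = ∑ n ∈ Finset.range (p - m), g n := by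
          refine (Finset.sum_subset (Finset.range_mono (by omega)) fun n _ hn => ?_).symm
          exact if_neg fun h => hn (Finset.mem_range.mpr h.1)
      _ = _ := by
          rw [Finset.mul_sum]
          refine Finset.sum_congr rfl fun n hn => ?_
          simp only [g, Finset.mem_range.mp hn, true_and, mul_ite, mul_zero]

lemma factorial_mul_TsumP_replicate_append (k l : ℕ) (hk : k % 2 = 1) (hl : l ≤ k)
    (hp2 : p ≠ 2) :
    ((k - l + 1).factorial : ZMod p) * ((l + 1).factorial *
      TsumP p (List.replicate l 1 ++ 2 :: List.replicate (k - l) 1)) =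
      (-1) ^ (l + 1) * PowerSeries.coeff p (oddLog p ^ (k + 2)) := by
  have hp : p.Prime := Fact.out
  rw [TsumP_eq_sum_chainSum p hp.pos, factorial_mul_sum_chainSum_replicate_append hp2 l 2 _
    (by simp only [List.length_replicate]; omega), mul_left_comm, Finset.mul_sum,
    show k + 2 = (k - l + 1) + (l + 1) by omega, pow_add (oddLog p) (k - l + 1), PowerSeries.coeff_mul,
    Finset.Nat.sum_antidiagonal_eq_sum_range_succ_mk, Finset.sum_range_succ, Nat.sub_self,
    coeff_zero_oddLog_pow_succ, mul_zero, add_zero]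
  congr 1
  refine Finset.sum_congr rfl fun n hn => ?_
  have hn := Finset.mem_range.mp hn
  rw [← factorial_mul_chainSum_replicate_one (k - l + 1) n hn, mul_assoc, List.replicate_succ,
    chainSum, chainSum]
  split_ifs with h
  · have hne := natCast_ne_zero_of_lt h.1 hn
    field_simp
  · simp

end

/-- For `k` odd, `0 ≤ ℓ ≤ k`, and every prime `p > k+2`:
`T_p({1}^ℓ, 2, {1}^{k−ℓ}) = (−1)^ℓ (ℓ+1)⁻¹ C(k+1, ℓ) · T_p(2, {1}^k)` in `ℤ/pℤ`. -/
theorem T_one_two_one (k ℓ : ℕ) (hk0 : 0 < k) (hk : Odd k) (hl : ℓ ≤ k)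
    (p : ℕ) (hp : p.Prime) (hpk : k + 2 < p) :
    TsumP p (List.replicate ℓ 1 ++ 2 :: List.replicate (k - ℓ) 1)
      = (-1 : ZMod p) ^ ℓ * ((ℓ + 1 : ZMod p))⁻¹ * ((k + 1).choose ℓ : ZMod p) *
        TsumP p (2 :: List.replicate k 1) := by
  have : Fact p.Prime := ⟨hp⟩
  have hfac : ∀ m < p, (m.factorial : ZMod p) ≠ 0 := fun m hm => by
    rw [Ne, ZMod.natCast_eq_zero_iff, hp.dvd_factorial]
    exact not_le.mpr hm
  have hk2 := Nat.odd_iff.mp hk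
  have h1 := factorial_mul_TsumP_replicate_append (p := p) k ℓ hk2 hl (by omega)
  have h0 := factorial_mul_TsumP_replicate_append (p := p) k 0 hk2 k.zero_le (by omega)
  simp only [List.replicate_zero, List.nil_append, Nat.sub_zero, zero_add, pow_one,
    Nat.factorial_one, Nat.cast_one, one_mul] at h0
  have hchoose : (((k + 1).choose ℓ : ℕ) : ZMod p) * ℓ.factorial * (k - ℓ + 1).factorial =
      (k + 1).factorial := by
    have := Nat.choose_mul_factorial_mul_factorial (show ℓ ≤ k + 1 by omega)
    rw [show k + 1 - ℓ = k - ℓ + 1 by omega] at this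
    rw [← this]
    push_cast
    rfl
  have hl1 := natCast_ne_zero_of_lt (p := p) (n := ℓ + 1) (by omega) (by omega)
  push_cast at hl1
  refine mul_left_cancel₀ (hfac (k - ℓ + 1) (by omega))
    (mul_left_cancel₀ (hfac (ℓ + 1) (by omega)) ?_)
  rw [mul_left_comm, h1, pow_succ, mul_assoc, ← h0, ← hchoose, Nat.factorial_succ ℓ]
  push_cast
  field_simp
end
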